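/- Consider stochastic coordinate descent: f : ℝ^d → ℝ nonnegative C² with ‖∇²f(w)‖ ≤ L for all w, and iterates w_{m+1} = w_m − α_m g_m on a filtered probability space, where w_m is 𝓕_m-measurable and the estimators g_m satisfy, almost surely, E[g_m | 𝓕_m] = ∇f(w_m), E[⟨∇f(w_m), g_m⟩ | 𝓕_m] = |∇f(w_m)|², and E[|g_m|² | 𝓕_m] = d·|∇f(w_m)|². If the deterministic step sizes α_m are nonincreasing with 0 ≤ α_m ≤ 1/(dL), ∑_{m=1}^∞ α_m = ∞, α_m → 0, and E[f(w_1)] < ∞, then: (i) E[f(w_m)] is monotone nonincreasing, and (ii) E[|∇f(w_m)|²] → 0 as m → ∞. -/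

import Mathlib

open Filter MeasureTheory ProbabilityTheory
open scoped RealInnerProductSpace

theorem aux_real (α G F : ℕ → ℝ) (C : ℝ) (hC : 0 ≤ C) (hα : ∀ m, 0 ≤ α m) (hG : ∀ m, 0 ≤ G m)
    (hF : ∀ m, 0 ≤ F m) (hFG : ∀ m, F (m + 1) ≤ F m - α m / 2 * G m)
    (hGG : ∀ m, G (m + 1) ≤ G m + C * (α m * G m))
    (hdiv : Tendsto (fun M => ∑ m ∈ Finset.range M, α m) atTop atTop) :
    Tendsto G atTop (nhds 0) := by
  have hnn : ∀ m, 0 ≤ α m * G m := fun m => mul_nonneg (hα m) (hG m)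
  have hb : ∀ n, ∑ m ∈ Finset.range n, α m * G m ≤ 2 * F 0 - 2 * F n := by
    intro n
    induction n with
    | zero => simp
    | succ k ih =>
      rw [Finset.sum_range_succ]
      have := hFG k
      linarith
  have hb' : ∀ n, ∑ m ∈ Finset.range n, α m * G m ≤ 2 * F 0 := fun n => by
    have := hb n
    have := hF n
    linarith
  have hsum : Summable (fun m => α m * G m) := summable_of_sum_range_le hnn hb'
  have hanti : Antitone (fun n => G n - C * ∑ m ∈ Finset.range n, α m * G m) := by
    apply antitone_nat_of_succ_le
    intro n
    rw [Finset.sum_range_succ]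
    have := hGG n
    linarith
  have hbdd : BddBelow (Set.range (fun n => G n - C * ∑ m ∈ Finset.range n, α m * G m)) := by
    refine ⟨- (C * (2 * F 0)), ?_⟩
    rintro _ ⟨n, rfl⟩
    have := mul_le_mul_of_nonneg_left (hb' n) hC
    have := hG n
    simp only
    linarith
  have h1 := tendsto_atTop_ciInf hanti hbdd
  have h2 := (hsum.hasSum.tendsto_sum_nat).const_mul C
  have h3 := h1.add h2
  simp only [sub_add_cancel] at h3
  generalize (⨅ n, (G n - C * ∑ m ∈ Finset.range n, α m * G m)) + C * ∑' m, α m * G m = l at h3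
  have hl : 0 ≤ l := ge_of_tendsto' h3 hG
  rcases hl.eq_or_lt with h0 | h0
  · rw [h0]; exact h3
  exfalso
  have hev : ∀ᶠ m in atTop, l / 2 < G m := h3.eventually (lt_mem_nhds (by linarith))
  have hs : Summable α := by
    refine Summable.of_norm_bounded_eventually_nat (hsum.mul_left (2 / l)) ?_
    filter_upwards [hev] with m hm
    rw [Real.norm_of_nonneg (hα m)]
    have : α m * (l / 2) ≤ α m * G m := mul_le_mul_of_nonneg_left hm.le (hα m)
    calc α m = 2 / l * (α m * (l / 2)) := by field_simp
      _ ≤ _ := by gcongr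
  exact not_tendsto_nhds_of_tendsto_atTop hdiv _ hs.hasSum.tendsto_sum_nat

section
variable {E : Type*} [NormedAddCommGroup E] [InnerProductSpace ℝ E] [CompleteSpace E]

theorem aux_contDiff_grad (f : E → ℝ) (hf : ContDiff ℝ 2 f) : ContDiff ℝ 1 (gradient f) := by
  have h : ContDiff ℝ 1 (fderiv ℝ f) := hf.fderiv_right (by norm_num)
  exact (InnerProductSpace.toDual ℝ E).symm.contDiff.comp h

theorem aux_lip (f : E → ℝ) (L : ℝ) (hf : ContDiff ℝ 2 f)
    (hHess : ∀ x, ‖fderiv ℝ (gradient f) x‖ ≤ L) (x y : E) :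
    ‖gradient f y - gradient f x‖ ≤ L * ‖y - x‖ :=
  convex_univ.norm_image_sub_le_of_norm_fderiv_le (𝕜 := ℝ)
    (fun z _ => ((aux_contDiff_grad f hf).differentiable (by norm_num)) z)
    (fun z _ => hHess z) (Set.mem_univ x) (Set.mem_univ y)

theorem aux_descent (f : E → ℝ) (L : ℝ) (hf : ContDiff ℝ 2 f)
    (hHess : ∀ x, ‖fderiv ℝ (gradient f) x‖ ≤ L) (x v : E) :
    f (x + v) ≤ f x + ⟪gradient f x, v⟫ + L / 2 * ‖v‖ ^ 2 := by
  have hder : ∀ t : ℝ, HasDerivAt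
      (fun t : ℝ => f (x + t • v) - t * ⟪gradient f x, v⟫ - L / 2 * t ^ 2 * ‖v‖ ^ 2)
      (⟪gradient f (x + t • v), v⟫ - ⟪gradient f x, v⟫ - L * t * ‖v‖ ^ 2) t := by
    intro t
    have h1 : HasDerivAt (fun t : ℝ => x + t • v) v t := by
      simpa using ((hasDerivAt_id t).smul_const v).const_add x
    have h2 := ((hf.differentiable (by norm_num)) (x + t • v)).hasGradientAt.hasFDerivAt
    have h3 : HasDerivAt (fun t : ℝ => f (x + t • v)) ⟪gradient f (x + t • v), v⟫ t := by
      have := h2.comp_hasDerivAt t h1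
      rw [InnerProductSpace.toDual_apply_apply] at this
      exact this
    have h4 := (hasDerivAt_id t).mul_const (⟪gradient f x, v⟫)
    have h5 := (((hasDerivAt_id t).pow 2).const_mul (L / 2)).mul_const (‖v‖ ^ 2)
    refine ((h3.sub h4).sub h5).congr_deriv ?_
    simp only [id]
    push_cast
    ring
  have hanti : AntitoneOn
      (fun t : ℝ => f (x + t • v) - t * ⟪gradient f x, v⟫ - L / 2 * t ^ 2 * ‖v‖ ^ 2)
      (Set.Ici 0) := by
    apply antitoneOn_of_deriv_nonpos (convex_Ici 0)
    · exact fun t _ => (hder t).continuousAt.continuousWithinAt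
    · exact fun t _ => (hder t).differentiableAt.differentiableWithinAt
    · intro t ht
      rw [interior_Ici] at ht
      have ht : 0 < t := ht
      rw [(hder t).deriv, ← inner_sub_left]
      have h1 := real_inner_le_norm (gradient f (x + t • v) - gradient f x) v
      have h2 := aux_lip f L hf hHess x (x + t • v)
      rw [add_sub_cancel_left, norm_smul, Real.norm_of_nonneg ht.le] at h2
      have h3 := mul_le_mul_of_nonneg_right h2 (norm_nonneg v)
      nlinarith
  have := hanti (show (0:ℝ) ∈ Set.Ici 0 by simp) (show (1:ℝ) ∈ Set.Ici 0 by simp) zero_le_one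
  simp only [one_smul, zero_smul, add_zero, one_mul, zero_mul] at this
  linarith

end

/-- stochastic coordinate descent. `f : ℝ^d → ℝ` nonnegative `C²` with
uniform Hessian bound `L`; iterates `w_{m+1} = w_m − α_m g_m` on a filtered probability
space (indexed from `0`, so `w 0` is the initial iterate `w_1`), with `w_m` measurable
w.r.t. `𝓕 m` and estimators satisfying a.s. `E[g_m | 𝓕_m] = ∇f(w_m)`,
`E[⟪∇f(w_m), g_m⟫ | 𝓕_m] = ‖∇f(w_m)‖²` and `E[‖g_m‖² | 𝓕_m] = d·‖∇f(w_m)‖²`. If the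
deterministic steps are nonincreasing with `0 ≤ α_m ≤ 1/(dL)`, `∑ α_m = ∞`, `α_m → 0`,
and `E[f(w_0)] < ∞`, then (i) `E[f(w_m)]` is monotone nonincreasing and
(ii) `E[‖∇f(w_m)‖²] → 0`. -/
theorem stmt15 {d : ℕ} (f : EuclideanSpace ℝ (Fin d) → ℝ) (L : ℝ)
    (hf : ContDiff ℝ 2 f) (hf0 : ∀ x, 0 ≤ f x)
    (hHess : ∀ x, ‖fderiv ℝ (gradient f) x‖ ≤ L) (hL : 0 < L) (hd : 0 < d)
    {Ω : Type*} [inst : MeasurableSpace Ω] (μ : Measure Ω) [IsProbabilityMeasure μ]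
    (𝓕 : ℕ → MeasurableSpace Ω) (h𝓕 : ∀ m, 𝓕 m ≤ inst)
    (w g : ℕ → Ω → EuclideanSpace ℝ (Fin d)) (α : ℕ → ℝ)
    (hw : ∀ m, StronglyMeasurable[𝓕 m] (w m))
    (hg : ∀ m, AEStronglyMeasurable (g m) μ)
    (hiter : ∀ m, ∀ ω, w (m + 1) ω = w m ω - α m • g m ω)
    (hunbiased : ∀ m, μ[g m | 𝓕 m] =ᵐ[μ] fun ω => gradient f (w m ω))
    (hip : ∀ m, μ[fun ω => ⟪gradient f (w m ω), g m ω⟫ | 𝓕 m] =ᵐ[μ]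
      fun ω => ‖gradient f (w m ω)‖ ^ 2)
    (hsqm : ∀ m, μ[fun ω => ‖g m ω‖ ^ 2 | 𝓕 m] =ᵐ[μ]
      fun ω => (d : ℝ) * ‖gradient f (w m ω)‖ ^ 2)
    (hg2 : ∀ m, Integrable (fun ω => ‖g m ω‖ ^ 2) μ)
    (hα : ∀ m, 0 ≤ α m) (hαL : ∀ m, α m ≤ 1 / (d * L)) (hmono : Antitone α)
    (hdiv : Tendsto (fun M => ∑ m ∈ Finset.range M, α m) atTop atTop)
    (hα0 : Tendsto α atTop (nhds 0))
    (hint : Integrable (fun ω => f (w 0 ω)) μ) :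
    Antitone (fun m => ∫ ω, f (w m ω) ∂μ) ∧
      Tendsto (fun m => ∫ ω, ‖gradient f (w m ω)‖ ^ 2 ∂μ) atTop (nhds 0) := by
  have hgc := (aux_contDiff_grad f hf).continuous
  have hdpos : (0 : ℝ) < d := by exact_mod_cast hd
  have hd1 : (1 : ℝ) ≤ d := by exact_mod_cast hd
  have hdLα : ∀ m, (d : ℝ) * L * α m ≤ 1 := by
    intro m
    have := hαL m
    rw [le_div_iff₀ (by positivity)] at this
    linarith
  have hLα : ∀ m, L * α m ≤ 1 := by
    intro m
    have h1 := hdLα m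
    have h2 : 0 ≤ L * α m := mul_nonneg hL.le (hα m)
    nlinarith
  have hwm : ∀ m, StronglyMeasurable (w m) := fun m => (hw m).mono (h𝓕 m)
  have hGm : ∀ m, AEStronglyMeasurable (fun ω => gradient f (w m ω)) μ := fun m =>
    (hgc.comp_stronglyMeasurable (hwm m)).aestronglyMeasurable
  have hGi : ∀ m, Integrable (fun ω => ‖gradient f (w m ω)‖ ^ 2) μ := by
    intro m
    have h1 : Integrable (fun ω => (d : ℝ) * ‖gradient f (w m ω)‖ ^ 2) μ :=
      (integrable_condExp).congr (hsqm m)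
    have h2 := h1.const_mul ((d : ℝ)⁻¹)
    refine h2.congr (ae_of_all _ fun ω => ?_)
    field_simp
  have hIi : ∀ m, Integrable (fun ω => ⟪gradient f (w m ω), g m ω⟫) μ := by
    intro m
    refine ((hGi m).add (hg2 m)).mono' ((hGm m).inner (hg m)) (ae_of_all _ fun ω => ?_)
    have h1 := norm_inner_le_norm (𝕜 := ℝ) (gradient f (w m ω)) (g m ω)
    simp only [Pi.add_apply]
    nlinarith [sq_nonneg (‖gradient f (w m ω)‖ - ‖g m ω‖), sq_nonneg ‖gradient f (w m ω)‖,
      sq_nonneg ‖g m ω‖]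
  have hI : ∀ m, ∫ ω, ⟪gradient f (w m ω), g m ω⟫ ∂μ = ∫ ω, ‖gradient f (w m ω)‖ ^ 2 ∂μ := by
    intro m
    rw [← integral_condExp (h𝓕 m)]
    exact integral_congr_ae (hip m)
  have hS : ∀ m, ∫ ω, ‖g m ω‖ ^ 2 ∂μ = d * ∫ ω, ‖gradient f (w m ω)‖ ^ 2 ∂μ := by
    intro m
    rw [← integral_condExp (h𝓕 m), ← integral_const_mul]
    exact integral_congr_ae (hsqm m)
  have hstep : ∀ m ω, f (w (m + 1) ω) ≤
      f (w m ω) - α m * ⟪gradient f (w m ω), g m ω⟫ + L / 2 * α m ^ 2 * ‖g m ω‖ ^ 2 := by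
    intro m ω
    have h := aux_descent f L hf hHess (w m ω) (-(α m • g m ω))
    rw [← sub_eq_add_neg, ← hiter, inner_neg_right, real_inner_smul_right, norm_neg, norm_smul,
      Real.norm_of_nonneg (hα m)] at h
    linarith
  have hRi : ∀ m, Integrable (fun ω => f (w m ω)) μ → Integrable (fun ω =>
      f (w m ω) - α m * ⟪gradient f (w m ω), g m ω⟫ + L / 2 * α m ^ 2 * ‖g m ω‖ ^ 2) μ := by
    intro m hm
    exact (hm.sub ((hIi m).const_mul _)).add ((hg2 m).const_mul _)
  have hfi : ∀ m, Integrable (fun ω => f (w m ω)) μ := by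
    intro m
    induction m with
    | zero => exact hint
    | succ m ih =>
      refine (hRi m ih).mono'
        (hf.continuous.comp_stronglyMeasurable (hwm (m + 1))).aestronglyMeasurable
        (ae_of_all _ fun ω => ?_)
      rw [Real.norm_of_nonneg (hf0 _)]
      exact hstep m ω
  have hGnn : ∀ m, 0 ≤ ∫ ω, ‖gradient f (w m ω)‖ ^ 2 ∂μ := fun m =>
    integral_nonneg fun ω => by positivity
  have hFstep : ∀ m, ∫ ω, f (w (m + 1) ω) ∂μ ≤
      ∫ ω, f (w m ω) ∂μ - α m / 2 * ∫ ω, ‖gradient f (w m ω)‖ ^ 2 ∂μ := by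
    intro m
    have h := integral_mono (hfi (m + 1)) (hRi m (hfi m)) (hstep m)
    rw [integral_add (f := fun ω => f (w m ω) - α m * ⟪gradient f (w m ω), g m ω⟫)
        ((hfi m).sub ((hIi m).const_mul _)) ((hg2 m).const_mul _),
      integral_sub (hfi m) ((hIi m).const_mul _), integral_const_mul, integral_const_mul,
      hI, hS] at h
    have h2 : d * L * α m * (α m * ∫ ω, ‖gradient f (w m ω)‖ ^ 2 ∂μ) ≤
        1 * (α m * ∫ ω, ‖gradient f (w m ω)‖ ^ 2 ∂μ) :=
      mul_le_mul_of_nonneg_right (hdLα m) (mul_nonneg (hα m) (hGnn m))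
    nlinarith
  have hGstep : ∀ m, ∫ ω, ‖gradient f (w (m + 1) ω)‖ ^ 2 ∂μ ≤
      ∫ ω, ‖gradient f (w m ω)‖ ^ 2 ∂μ +
        (L * (1 + 2 * d)) * (α m * ∫ ω, ‖gradient f (w m ω)‖ ^ 2 ∂μ) := by
    intro m
    have hp : ∀ ω, ‖gradient f (w (m + 1) ω)‖ ^ 2 ≤
        (1 + L * α m) * ‖gradient f (w m ω)‖ ^ 2 + 2 * (L * α m) * ‖g m ω‖ ^ 2 := by
      intro ω
      have h1 := aux_lip f L hf hHess (w m ω) (w (m + 1) ω)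
      have h2 : ‖w (m + 1) ω - w m ω‖ = α m * ‖g m ω‖ := by
        rw [hiter, sub_sub_cancel_left, norm_neg, norm_smul, Real.norm_of_nonneg (hα m)]
      rw [h2] at h1
      have h3 := norm_le_norm_add_norm_sub (gradient f (w m ω)) (gradient f (w (m + 1) ω))
      have h3' : ‖gradient f (w (m + 1) ω)‖ ≤
          ‖gradient f (w m ω)‖ + (L * α m) * ‖g m ω‖ := by
        have := norm_sub_norm_le (gradient f (w (m + 1) ω)) (gradient f (w m ω))
        linarith
      have h4 := pow_le_pow_left₀ (norm_nonneg _) h3' 2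
      have h5 : 0 ≤ L * α m := mul_nonneg hL.le (hα m)
      have hc1 := hLα m
      generalize L * α m = c at *
      have h6 := mul_nonneg h5 (sq_nonneg (‖gradient f (w m ω)‖ - ‖g m ω‖))
      have h7 := mul_nonneg (mul_nonneg h5 (sub_nonneg.2 hc1)) (sq_nonneg ‖g m ω‖)
      nlinarith
    have h := integral_mono (hGi (m + 1))
      (((hGi m).const_mul (1 + L * α m)).add ((hg2 m).const_mul (2 * (L * α m)))) hp
    simp only [Pi.add_apply] at h
    rw [integral_add ((hGi m).const_mul _) ((hg2 m).const_mul _), integral_const_mul,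
      integral_const_mul, hS] at h
    linarith
  refine ⟨antitone_nat_of_succ_le fun m => ?_, ?_⟩
  · have := hFstep m
    have := mul_nonneg (hα m) (hGnn m)
    linarith
  · exact aux_real α _ (fun m => ∫ ω, f (w m ω) ∂μ) (L * (1 + 2 * d)) (by positivity) hα hGnn
      (fun m => integral_nonneg fun ω => hf0 _) hFstep hGstep hdiv
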